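/- As N → ∞, the partial sums S_N = ∑_{n=1}^N R_2(n), where R_2(n) := log Γ(n) − n log n + n + (1/2) log n − (1/2) log(2π) − 1/(12n), converge to 2 ζ'(−1) − 1/12 − γ/12 + (1/4) log(2π). -/

import Mathlib

open Filter

/-- Third-order Euler–Maclaurin estimate on a unit interval. -/
theorem norm_trapezoid_sub_le {E : Type*} [NormedAddCommGroup E] [NormedSpace ℝ E]
    {Φ φ φ₁ φ₂ φ₃ : ℝ → E} {a C : ℝ}
    (hΦ : ∀ x ∈ Set.Icc a (a + 1), HasDerivAt Φ (φ x) x)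
    (hφ : ∀ x ∈ Set.Icc a (a + 1), HasDerivAt φ (φ₁ x) x)
    (hφ₁ : ∀ x ∈ Set.Icc a (a + 1), HasDerivAt φ₁ (φ₂ x) x)
    (hφ₂ : ∀ x ∈ Set.Icc a (a + 1), HasDerivAt φ₂ (φ₃ x) x)
    (hC : ∀ x ∈ Set.Icc a (a + 1), ‖φ₃ x‖ ≤ C) :
    ‖(1 / 2 : ℝ) • (φ a + φ (a + 1)) - (Φ (a + 1) - Φ a)
      - (1 / 12 : ℝ) • (φ₁ (a + 1) - φ₁ a)‖ ≤ C := by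
  set F : ℝ → E := fun x =>
    ((x - a) ^ 3 / 6 - (x - a) ^ 2 / 4 + (x - a) / 12) • φ₂ x
      - ((x - a) ^ 2 / 2 - (x - a) / 2 + 1 / 12) • φ₁ x + (x - a - 1 / 2) • φ x - Φ x with hF
  have hd : ∀ x ∈ Set.Icc a (a + 1), HasDerivAt F
      (((x - a) ^ 3 / 6 - (x - a) ^ 2 / 4 + (x - a) / 12) • φ₃ x) x := by
    intro x hx
    have h1 : HasDerivAt (fun x : ℝ => x - a) 1 x := (hasDerivAt_id x).sub_const a
    have hK2 : HasDerivAt (fun x : ℝ => x - a - 1 / 2) 1 x := h1.sub_const _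
    have hK1 : HasDerivAt (fun x : ℝ => (x - a) ^ 2 / 2 - (x - a) / 2 + 1 / 12)
        (x - a - 1 / 2) x := by
      refine ((((h1.pow 2).div_const 2).sub (h1.div_const 2)).add_const (1 / 12 : ℝ)).congr_deriv ?_
      norm_num
    have hK0 : HasDerivAt (fun x : ℝ => (x - a) ^ 3 / 6 - (x - a) ^ 2 / 4 + (x - a) / 12)
        ((x - a) ^ 2 / 2 - (x - a) / 2 + 1 / 12) x := by
      refine ((((h1.pow 3).div_const 6).sub ((h1.pow 2).div_const 4)).add
        (h1.div_const 12)).congr_deriv ?_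
      norm_num; ring
    refine ((((hK0.smul (hφ₂ x hx)).sub (hK1.smul (hφ₁ x hx))).add
      (hK2.smul (hφ x hx))).sub (hΦ x hx)).congr_deriv ?_
    module
  have hbound : ∀ x ∈ Set.Ico a (a + 1),
      ‖((x - a) ^ 3 / 6 - (x - a) ^ 2 / 4 + (x - a) / 12) • φ₃ x‖ ≤ C := by
    intro x hx
    have h0 : 0 ≤ x - a := by linarith [hx.1]
    have h1 : x - a ≤ 1 := by linarith [hx.2]
    have hK : |(x - a) ^ 3 / 6 - (x - a) ^ 2 / 4 + (x - a) / 12| ≤ 1 := by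
      rw [abs_le]
      have h2 : (x - a) ^ 2 ≤ 1 := by nlinarith
      have h3 : (x - a) ^ 3 ≤ 1 := by nlinarith [pow_nonneg h0 2]
      constructor <;> nlinarith [pow_nonneg h0 2, pow_nonneg h0 3]
    rw [norm_smul, Real.norm_eq_abs]
    calc _ ≤ 1 * ‖φ₃ x‖ := by gcongr
      _ ≤ C := by rw [one_mul]; exact hC x ⟨hx.1, hx.2.le⟩
  have := norm_image_sub_le_of_norm_deriv_le_segment'
    (fun x hx => (hd x hx).hasDerivWithinAt) hbound (a + 1) ⟨by linarith, le_rfl⟩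
  convert this using 1
  · congr 1
    simp only [hF, add_sub_cancel_left, sub_self]
    module
  · ring

theorem mul_tendsto_zero_of_abs_sub_le {v : ℕ → ℝ} {C : ℝ} (hv : Tendsto v atTop (nhds 0))
    (h : ∀ n : ℕ, 1 ≤ n → |v (n + 1) - v n| ≤ C / (n : ℝ) ^ 3) :
    Tendsto (fun n : ℕ => (n : ℝ) * v n) atTop (nhds 0) := by
  have hC : 0 ≤ C := by simpa using (abs_nonneg _).trans (h 1 le_rfl)
  have hstep : ∀ n : ℕ, 1 ≤ n →
      |v (n + 1) - v n| ≤ 2 * C / (n : ℝ) ^ 2 - 2 * C / ((n + 1 : ℕ) : ℝ) ^ 2 := by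
    intro n hn
    refine (h n hn).trans ?_
    have h1 : (1 : ℝ) ≤ n := by exact_mod_cast hn
    have h0 : (0 : ℝ) < n := by linarith
    have e : 2 * C / (n : ℝ) ^ 2 - 2 * C / ((n + 1 : ℕ) : ℝ) ^ 2 - C / (n : ℝ) ^ 3
        = C * (3 * (n : ℝ) ^ 2 - 1) / ((n : ℝ) ^ 3 * (n + 1) ^ 2) := by
      push_cast; field_simp; ring
    have : 0 ≤ C * (3 * (n : ℝ) ^ 2 - 1) / ((n : ℝ) ^ 3 * (n + 1) ^ 2) := by
      have : 0 ≤ 3 * (n : ℝ) ^ 2 - 1 := by nlinarith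
      positivity
    linarith
  have hlim : Tendsto (fun n : ℕ => 2 * C / (n : ℝ) ^ 2) atTop (nhds 0) :=
    tendsto_const_nhds.div_atTop
      ((tendsto_pow_atTop two_ne_zero).comp tendsto_natCast_atTop_atTop)
  have hup : ∀ n : ℕ, 1 ≤ n → |v n| ≤ 2 * C / (n : ℝ) ^ 2 := by
    intro n hn
    have hle : ∀ m : ℕ, n ≤ m → |v n - v m| ≤ 2 * C / (n : ℝ) ^ 2 - 2 * C / (m : ℝ) ^ 2 := by
      intro m hm
      induction m, hm using Nat.le_induction with
      | base => simp
      | succ m hm ih =>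
        have := abs_sub_le (v n) (v m) (v (m + 1))
        rw [abs_sub_comm (v m)] at this
        linarith [hstep m (hn.trans hm)]
    have h1 : Tendsto (fun m => |v n - v m|) atTop (nhds |v n - 0|) :=
      (tendsto_const_nhds.sub hv).abs
    have h2 := (tendsto_const_nhds (x := 2 * C / (n : ℝ) ^ 2)).sub hlim
    simpa using le_of_tendsto_of_tendsto h1 h2 (eventually_atTop.2 ⟨n, hle⟩)
  have hlim' : Tendsto (fun n : ℕ => 2 * C / (n : ℝ)) atTop (nhds 0) :=
    tendsto_const_nhds.div_atTop tendsto_natCast_atTop_atTop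
  refine squeeze_zero_norm' ?_ hlim'
  filter_upwards [eventually_ge_atTop 1] with n hn
  have h0 : (0 : ℝ) < n := by exact_mod_cast hn
  rw [Real.norm_eq_abs, abs_mul, abs_of_pos h0]
  calc _ ≤ (n : ℝ) * (2 * C / (n : ℝ) ^ 2) := by gcongr; exact hup n hn
    _ = _ := by field_simp

theorem tendsto_log_factorial_sub_stirling :
    Tendsto (fun n : ℕ => Real.log n.factorial -
      (n * Real.log n - n + Real.log n / 2 + Real.log (2 * Real.pi) / 2 + 1 / (12 * n)))
      atTop (nhds 0) := by
  have h1 : Tendsto (fun n : ℕ => Real.log (Stirling.stirlingSeq n)) atTop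
      (nhds (Real.log (√Real.pi))) :=
    Stirling.tendsto_stirlingSeq_sqrt_pi.log (by positivity)
  have h2 : Tendsto (fun n : ℕ => 1 / (12 * (n : ℝ))) atTop (nhds 0) :=
    tendsto_const_nhds.div_atTop
      (tendsto_natCast_atTop_atTop.const_mul_atTop (by norm_num))
  have h3 := (h1.sub_const (Real.log (√Real.pi))).sub h2
  rw [sub_self, sub_zero] at h3
  refine h3.congr' ?_
  filter_upwards [eventually_ge_atTop 1] with n hn
  have h0 : (0 : ℝ) < n := by exact_mod_cast hn
  rw [Stirling.log_stirlingSeq_formula, Real.log_sqrt Real.pi_pos.le,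
    Real.log_div h0.ne' (Real.exp_pos 1).ne', Real.log_exp, Real.log_mul two_ne_zero h0.ne',
    Real.log_mul two_ne_zero Real.pi_pos.ne']
  ring

theorem tendsto_mul_log_factorial_sub_stirling :
    Tendsto (fun n : ℕ => (n : ℝ) * (Real.log n.factorial -
      (n * Real.log n - n + Real.log n / 2 + Real.log (2 * Real.pi) / 2 + 1 / (12 * n))))
      atTop (nhds 0) := by
  refine mul_tendsto_zero_of_abs_sub_le (C := 2) tendsto_log_factorial_sub_stirling ?_
  intro n hn
  have h0 : (0 : ℝ) < n := by exact_mod_cast hn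
  have hpos : ∀ x ∈ Set.Icc (n : ℝ) (n + 1), 0 < x := fun x hx => h0.trans_le hx.1
  have key := norm_trapezoid_sub_le (Φ := fun x => x * Real.log x - x) (φ := Real.log)
    (φ₁ := fun x => x⁻¹) (φ₂ := fun x => -(x ^ 2)⁻¹) (φ₃ := fun x => 2 / x ^ 3)
    (a := n) (C := 2 / (n : ℝ) ^ 3)
    (fun x hx => by
      have hx := (hpos x hx).ne'
      refine (((hasDerivAt_id x).mul (Real.hasDerivAt_log hx)).sub
        (hasDerivAt_id x)).congr_deriv ?_
      simp [hx])
    (fun x hx => Real.hasDerivAt_log (hpos x hx).ne')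
    (fun x hx => hasDerivAt_inv (hpos x hx).ne')
    (fun x hx => by
      have hx := (hpos x hx).ne'
      refine (((hasDerivAt_pow 2 x).inv (pow_ne_zero 2 hx)).neg).congr_deriv ?_
      field_simp
      norm_num [mul_comm])
    (fun x hx => by
      have := hpos x hx
      rw [Real.norm_of_nonneg (by positivity)]
      have := hx.1
      gcongr)
  refine le_trans (le_of_eq ?_) key
  rw [Real.norm_eq_abs]
  congr 1
  have h1 : (n : ℝ) + 1 ≠ 0 := by positivity
  have hf : (n.factorial : ℝ) ≠ 0 := by positivity
  rw [Nat.factorial_succ]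
  push_cast
  rw [Real.log_mul h1 hf]
  simp only [smul_eq_mul]
  field_simp
  ring

theorem hasDerivAt_ofReal_cpow_of_pos {x : ℝ} (hx : 0 < x) (r : ℂ) :
    HasDerivAt (fun y : ℝ => (y : ℂ) ^ r) (r * (x : ℂ) ^ (r - 1)) x := by
  rcases eq_or_ne r 0 with rfl | hr
  · simpa using hasDerivAt_const x (1 : ℂ)
  · exact hasDerivAt_ofReal_cpow_const hx.ne' hr

/-- The second-order Euler–Maclaurin approximation to `ζ(s)`. -/
noncomputable def zetaApprox (N : ℕ) (s : ℂ) : ℂ :=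
  ∑ k ∈ Finset.range N, ((k + 1 : ℕ) : ℂ) ^ (-s) - (N : ℂ) ^ (1 - s) / (1 - s)
    - (N : ℂ) ^ (-s) / 2 + s * (N : ℂ) ^ (-s - 1) / 12

theorem norm_zetaApprox_succ_sub_le {n : ℕ} (hn : 1 ≤ n) {s : ℂ} (hs : s ≠ 1)
    (hre : -3 ≤ s.re) :
    ‖zetaApprox (n + 1) s - zetaApprox n s‖
      ≤ ‖s‖ * ‖s + 1‖ * ‖s + 2‖ * (n : ℝ) ^ (-s.re - 3) := by
  have h0 : (0 : ℝ) < n := by exact_mod_cast hn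
  have hpos : ∀ x ∈ Set.Icc (n : ℝ) (n + 1), 0 < x := fun x hx => h0.trans_le hx.1
  have hs' : 1 - s ≠ 0 := sub_ne_zero.2 hs.symm
  have key := norm_trapezoid_sub_le (Φ := fun x : ℝ => (x : ℂ) ^ (1 - s) / (1 - s))
    (φ := fun x : ℝ => (x : ℂ) ^ (-s))
    (φ₁ := fun x : ℝ => -s * (x : ℂ) ^ (-s - 1))
    (φ₂ := fun x : ℝ => -s * ((-s - 1) * (x : ℂ) ^ (-s - 1 - 1)))
    (φ₃ := fun x : ℝ => -s * ((-s - 1) * ((-s - 1 - 1) * (x : ℂ) ^ (-s - 1 - 1 - 1))))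
    (a := n) (C := ‖s‖ * ‖s + 1‖ * ‖s + 2‖ * (n : ℝ) ^ (-s.re - 3))
    (fun x hx => by
      refine ((hasDerivAt_ofReal_cpow_of_pos (hpos x hx) (1 - s)).div_const _).congr_deriv ?_
      rw [mul_div_cancel_left₀ _ hs']
      ring_nf)
    (fun x hx => hasDerivAt_ofReal_cpow_of_pos (hpos x hx) _)
    (fun x hx => (hasDerivAt_ofReal_cpow_of_pos (hpos x hx) _).const_mul _)
    (fun x hx => ((hasDerivAt_ofReal_cpow_of_pos (hpos x hx) _).const_mul _).const_mul _)
    (fun x hx => by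
      have e : -s * ((-s - 1) * ((-s - 1 - 1) * (x : ℂ) ^ (-s - 1 - 1 - 1)))
          = -(s * (s + 1) * (s + 2) * (x : ℂ) ^ (-s - 1 - 1 - 1)) := by ring
      rw [e, norm_neg, norm_mul, norm_mul, norm_mul,
        Complex.norm_cpow_eq_rpow_re_of_pos (hpos x hx)]
      have e2 : (-s - 1 - 1 - 1).re = -s.re - 3 := by simp; ring
      rw [e2]
      exact mul_le_mul_of_nonneg_left
        (Real.rpow_le_rpow_of_nonpos h0 hx.1 (by linarith)) (by positivity))
  refine le_trans (le_of_eq ?_) key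
  congr 1
  simp only [zetaApprox, Finset.sum_range_succ, Complex.real_smul]
  push_cast
  ring

theorem tendsto_zetaApprox {s : ℂ} (hs : 1 < s.re) :
    Tendsto (fun N : ℕ => zetaApprox N s) atTop (nhds (riemannZeta s)) := by
  have hz : ∀ r : ℂ, r.re < 0 → Tendsto (fun N : ℕ => (N : ℂ) ^ r) atTop (nhds 0) := by
    intro r hr
    rw [tendsto_zero_iff_norm_tendsto_zero]
    have h1 : Tendsto (fun N : ℕ => (N : ℝ) ^ (-(-r.re))) atTop (nhds 0) :=
      (tendsto_rpow_neg_atTop (neg_pos.2 hr)).comp tendsto_natCast_atTop_atTop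
    refine h1.congr' ?_
    filter_upwards [eventually_ge_atTop 1] with n hn
    rw [neg_neg]
    exact (Complex.norm_natCast_cpow_of_pos hn r).symm
  have hsum : Tendsto (fun N : ℕ => ∑ k ∈ Finset.range N, ((k + 1 : ℕ) : ℂ) ^ (-s)) atTop
      (nhds (riemannZeta s)) := by
    rw [zeta_eq_tsum_one_div_nat_add_one_cpow hs]
    have hsm : Summable fun n : ℕ => 1 / (n + 1 : ℂ) ^ s := by
      simpa using (summable_nat_add_iff 1).2 (Complex.summable_one_div_nat_cpow.2 hs)
    refine hsm.hasSum.tendsto_sum_nat.congr fun N => ?_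
    refine Finset.sum_congr rfl fun k _ => ?_
    rw [Complex.cpow_neg, one_div]
    push_cast
    rfl
  have := ((hsum.sub ((hz (1 - s) (by simpa using hs)).div_const (1 - s))).sub
    ((hz (-s) (by simp; linarith)).div_const 2)).add
    (((hz (-s - 1) (by simp; linarith)).const_mul s).div_const 12)
  simpa [zetaApprox] using this

theorem differentiableAt_zetaApprox {N : ℕ} (hN : 1 ≤ N) {s : ℂ} (hs : s ≠ 1) :
    DifferentiableAt ℂ (zetaApprox N) s := by
  have hs' : 1 - s ≠ 0 := sub_ne_zero.2 hs.symm
  have hN' : (N : ℂ) ≠ 0 := by exact_mod_cast (by omega : N ≠ 0)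
  have hk : ∀ k : ℕ, ((k + 1 : ℕ) : ℂ) ≠ 0 := fun k => by exact_mod_cast k.succ_ne_zero
  unfold zetaApprox
  refine DifferentiableAt.add (DifferentiableAt.sub (DifferentiableAt.sub
    (DifferentiableAt.fun_sum fun k _ => ?_) (DifferentiableAt.div ?_ (by fun_prop) hs')) ?_) ?_
  · exact DifferentiableAt.const_cpow (by fun_prop) (Or.inl (hk k))
  · exact DifferentiableAt.const_cpow (by fun_prop) (Or.inl hN')
  · exact (DifferentiableAt.const_cpow (by fun_prop) (Or.inl hN')).div_const 2
  · exact ((differentiableAt_id).mul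
      (DifferentiableAt.const_cpow (by fun_prop) (Or.inl hN'))).div_const 12

theorem tendsto_deriv_zetaApprox_neg_one :
    Tendsto (fun N : ℕ => deriv (zetaApprox N) (-1)) atTop (nhds (deriv riemannZeta (-1))) := by
  set U : Set ℂ := {s | -(3 / 2) < s.re} ∩ Metric.ball 0 4 ∩ {s | s.re - s.im < 0} with hU
  have hUo : IsOpen U := by
    refine (IsOpen.inter ?_ Metric.isOpen_ball).inter ?_
    · exact isOpen_lt continuous_const Complex.continuous_re
    · exact isOpen_lt (Complex.continuous_re.sub Complex.continuous_im) continuous_const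
  have hUc : Convex ℝ U := by
    refine ((convex_halfSpace_re_gt _).inter (convex_ball 0 4)).inter ?_
    exact convex_halfSpace_lt (Complex.reLm - Complex.imLm).isLinear 0
  have hU1 : ∀ s ∈ U, s ≠ 1 := by
    rintro s ⟨-, h⟩ rfl
    norm_num at h
  have hm1 : (-1 : ℂ) ∈ U := by
    refine ⟨⟨?_, ?_⟩, ?_⟩ <;> norm_num
  have hz0 : (2 + 3 * Complex.I : ℂ) ∈ U := by
    refine ⟨⟨?_, ?_⟩, ?_⟩
    · norm_num
    · rw [mem_ball_zero_iff, ← abs_of_pos (show (0 : ℝ) < 4 by norm_num),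
        ← abs_norm, ← sq_lt_sq, ← Complex.normSq_eq_norm_sq, Complex.normSq_apply]
      norm_num
    · norm_num
  have hd : ∀ (n : ℕ) (s : ℂ), s ∈ U → DifferentiableAt ℂ (zetaApprox (n + 1)) s :=
    fun n s hs => differentiableAt_zetaApprox n.succ_pos (hU1 s hs)
  set F : ℕ → ℂ → ℂ := fun i s => zetaApprox (i + 1 + 1) s - zetaApprox (i + 1) s with hF
  have hFd : ∀ i, DifferentiableOn ℂ (F i) U := fun i s hs =>
    ((hd (i + 1) s hs).sub (hd i s hs)).differentiableWithinAt
  set u : ℕ → ℝ := fun i => 4 * 5 * 6 * ((i + 1 : ℕ) : ℝ) ^ (-(3 / 2) : ℝ) with hu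
  have hus : Summable u := by
    refine Summable.mul_left _ ?_
    exact (summable_nat_add_iff 1).2 (Real.summable_nat_rpow.2 (by norm_num))
  have hFu : ∀ (i : ℕ) (s : ℂ), s ∈ U → ‖F i s‖ ≤ u i := by
    intro i s hs
    have hre : -(3 / 2) < s.re := hs.1.1
    have hn : ‖s‖ ≤ 4 := (mem_ball_zero_iff.1 hs.1.2).le
    refine (norm_zetaApprox_succ_sub_le i.succ_pos (hU1 s hs) (by linarith)).trans ?_
    have h1 : ‖s + 1‖ ≤ 5 := (norm_add_le _ _).trans (by norm_num; linarith)
    have h2 : ‖s + 2‖ ≤ 6 := (norm_add_le _ _).trans (by norm_num; linarith)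
    have h3 : ((i + 1 : ℕ) : ℝ) ^ (-s.re - 3) ≤ ((i + 1 : ℕ) : ℝ) ^ (-(3 / 2) : ℝ) :=
      Real.rpow_le_rpow_of_exponent_le (by simp) (by linarith)
    simp only [hu]
    gcongr
  have hG : DifferentiableOn ℂ (fun s => (∑' i, F i s) + zetaApprox 1 s) U :=
    (Complex.differentiableOn_tsum_of_summable_norm hus hFd hUo hFu).add
      fun s hs => (hd 0 s hs).differentiableWithinAt
  have hζ : DifferentiableOn ℂ riemannZeta U := fun s hs =>
    (differentiableAt_riemannZeta (hU1 s hs)).differentiableWithinAt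
  have heq : Set.EqOn (fun s => (∑' i, F i s) + zetaApprox 1 s) riemannZeta U := by
    refine (hG.analyticOnNhd hUo).eqOn_of_preconnected_of_eventuallyEq
      (hζ.analyticOnNhd hUo) hUc.isPreconnected hz0 ?_
    have hV : IsOpen {s : ℂ | 1 < s.re} := isOpen_lt continuous_const Complex.continuous_re
    filter_upwards [hUo.mem_nhds hz0, hV.mem_nhds (by norm_num : (1 : ℝ) < _)] with s hsU hs
    have h1 : Summable fun i => F i s :=
      Summable.of_norm_bounded hus fun i => hFu i s hsU
    have h2 := h1.hasSum.tendsto_sum_nat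
    simp only [hF, Finset.sum_range_sub (fun i => zetaApprox (i + 1) s)] at h2
    have h3 := (((tendsto_add_atTop_iff_nat 1).2 (tendsto_zetaApprox hs))).sub_const
      (zetaApprox (0 + 1) s)
    have h4 := tendsto_nhds_unique h2 h3
    simp only [hF]
    rw [h4]
    simp
  have hT : DifferentiableAt ℂ (fun s => ∑' i, F i s) (-1) :=
    (Complex.differentiableOn_tsum_of_summable_norm hus hFd hUo hFu).differentiableAt
      (hUo.mem_nhds hm1)
  have hderiv : deriv (fun s => ∑' i, F i s) (-1) + deriv (zetaApprox 1) (-1)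
      = deriv riemannZeta (-1) := by
    rw [← (heq.eventuallyEq_of_mem (hUo.mem_nhds hm1)).deriv_eq]
    exact (deriv_fun_add hT (hd 0 _ hm1)).symm
  have hs := (Complex.hasSum_deriv_of_summable_norm hus hFd hUo hFu hm1).tendsto_sum_nat
  have hFi : ∀ i, deriv (F i) (-1)
      = deriv (zetaApprox (i + 1 + 1)) (-1) - deriv (zetaApprox (i + 1)) (-1) := fun i =>
    deriv_fun_sub (hd (i + 1) _ hm1) (hd i _ hm1)
  simp only [hFi, Finset.sum_range_sub (fun i => deriv (zetaApprox (i + 1)) (-1))] at hs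
  have := hs.add_const (deriv (zetaApprox 1) (-1))
  rw [hderiv] at this
  simpa using (tendsto_add_atTop_iff_nat 1).1 (by simpa using this)

theorem deriv_zetaApprox_neg_one {N : ℕ} (hN : 1 ≤ N) :
    deriv (zetaApprox N) (-1) =
      ((1 / 12 - (∑ n ∈ Finset.Icc 1 N, (n : ℝ) * Real.log n
        - ((N : ℝ) ^ 2 / 2 + N / 2 + 1 / 12) * Real.log N + (N : ℝ) ^ 2 / 4) : ℝ) : ℂ) := by
  have hN' : (N : ℂ) ≠ 0 := by exact_mod_cast (by omega : N ≠ 0)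
  have hneg : HasDerivAt (fun s : ℂ => -s) (-1) (-1) := (hasDerivAt_id _).neg
  have hsum : HasDerivAt (fun s : ℂ => ∑ k ∈ Finset.range N, ((k + 1 : ℕ) : ℂ) ^ (-s))
      (∑ k ∈ Finset.range N, ((k + 1 : ℕ) : ℂ) ^ (-(-1 : ℂ)) * Complex.log ((k + 1 : ℕ) : ℂ)
        * -1) (-1) :=
    HasDerivAt.fun_sum fun k _ =>
      hneg.const_cpow (Or.inl (by exact_mod_cast k.succ_ne_zero))
  have hone : HasDerivAt (fun s : ℂ => 1 - s) (-1) (-1) := (hasDerivAt_id _).const_sub 1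
  have hsub : HasDerivAt (fun s : ℂ => -s - 1) (-1) (-1) := hneg.sub_const 1
  have h := ((hsum.sub ((hone.const_cpow (c := (N : ℂ)) (Or.inl hN')).div hone
      (by norm_num))).sub
    ((hneg.const_cpow (c := (N : ℂ)) (Or.inl hN')).div_const 2)).add
    (((hasDerivAt_id (-1 : ℂ)).mul (hsub.const_cpow (c := (N : ℂ)) (Or.inl hN'))).div_const 12)
  have hlog : ∀ k : ℕ, Complex.log (k : ℂ) = (Real.log k : ℂ) := fun k =>
    Complex.natCast_log.symm
  have hIcc : ∑ n ∈ Finset.Icc 1 N, (n : ℝ) * Real.log n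
      = ∑ k ∈ Finset.range N, ((k + 1 : ℕ) : ℝ) * Real.log ((k + 1 : ℕ) : ℝ) := by
    rw [Finset.range_eq_Ico, Finset.sum_Ico_add' (fun n : ℕ => (n : ℝ) * Real.log n) 0 N 1]
    rfl
  refine (h.congr_deriv ?_).deriv
  have e2 : (1 : ℂ) - -1 = (2 : ℕ) := by norm_num
  rw [hIcc]
  simp only [hlog, neg_neg, Complex.cpow_one, sub_self, Complex.cpow_zero, e2,
    Complex.cpow_natCast, mul_neg, mul_one, Finset.sum_neg_distrib, id]
  push_cast
  ring

theorem tendsto_sum_mul_log :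
    Tendsto (fun N : ℕ => ∑ n ∈ Finset.Icc 1 N, (n : ℝ) * Real.log n
        - ((N : ℝ) ^ 2 / 2 + N / 2 + 1 / 12) * Real.log N + (N : ℝ) ^ 2 / 4)
      atTop (nhds (1 / 12 - (deriv riemannZeta (-1)).re)) := by
  have h := (Complex.continuous_re.tendsto _).comp tendsto_deriv_zetaApprox_neg_one
  refine (h.const_sub (1 / 12)).congr' ?_
  filter_upwards [eventually_ge_atTop 1] with N hN
  rw [Function.comp_apply, deriv_zetaApprox_neg_one hN, Complex.ofReal_re]
  ring

theorem sum_log_Gamma (N : ℕ) :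
    ∑ n ∈ Finset.Icc 1 N, Real.log (Real.Gamma n) =
      N * Real.log N.factorial - ∑ n ∈ Finset.Icc 1 N, (n : ℝ) * Real.log n := by
  induction N with
  | zero => simp
  | succ N ih =>
    rw [Finset.sum_Icc_succ_top (by omega), Finset.sum_Icc_succ_top (by omega), ih,
      Nat.factorial_succ]
    push_cast
    rw [Real.Gamma_nat_eq_factorial, Real.log_mul (by positivity) (by positivity)]
    ring

theorem sum_log_eq_log_factorial (N : ℕ) :
    ∑ n ∈ Finset.Icc 1 N, Real.log n = Real.log N.factorial := by
  induction N with
  | zero => simp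
  | succ N ih =>
    rw [Finset.sum_Icc_succ_top (by omega), ih, Nat.factorial_succ]
    push_cast
    rw [Real.log_mul (by positivity) (by positivity)]
    ring

theorem sum_Icc_natCast (N : ℕ) :
    ∑ n ∈ Finset.Icc 1 N, (n : ℝ) = N * (N + 1) / 2 := by
  induction N with
  | zero => simp
  | succ N ih =>
    rw [Finset.sum_Icc_succ_top (by omega), ih]
    push_cast
    ring

theorem stmt_12 :
    Tendsto
      (fun N : ℕ => ∑ n ∈ Finset.Icc 1 N,
        (Real.log (Real.Gamma n) - n * Real.log n + n + (1 / 2) * Real.log n -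
          (1 / 2) * Real.log (2 * Real.pi) - 1 / (12 * n)))
      atTop
      (nhds (2 * (deriv riemannZeta (-1)).re - 1 / 12 -
        Real.eulerMascheroniConstant / 12 + (1 / 4) * Real.log (2 * Real.pi))) := by
  have h1 := tendsto_mul_log_factorial_sub_stirling
  have h0 := tendsto_log_factorial_sub_stirling
  have h2 := tendsto_sum_mul_log
  have h3 := Real.tendsto_harmonic_sub_log
  have h4 : Tendsto (fun N : ℕ => 1 / (24 * (N : ℝ))) atTop (nhds 0) :=
    tendsto_const_nhds.div_atTop
      (tendsto_natCast_atTop_atTop.const_mul_atTop (by norm_num))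
  have key := ((((h1.add (h0.div_const 2)).sub (h2.const_mul 2)).sub (h3.div_const 12)).add
    h4).add_const (1 / 12 + (1 / 4) * Real.log (2 * Real.pi))
  convert key.congr' ?_ using 2
  · ring
  filter_upwards [eventually_ge_atTop 1] with N hN
  have hpos : (0 : ℝ) < N := by exact_mod_cast hN
  have hH : ∑ n ∈ Finset.Icc 1 N, 1 / (12 * (n : ℝ)) = (harmonic N : ℝ) / 12 := by
    rw [harmonic_eq_sum_Icc]
    push_cast
    rw [Finset.sum_div]
    refine Finset.sum_congr rfl fun n _ => ?_
    rw [one_div, mul_inv]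
    ring
  simp only [Finset.sum_sub_distrib, Finset.sum_add_distrib, ← Finset.mul_sum, sum_log_Gamma,
    sum_log_eq_log_factorial, sum_Icc_natCast, hH, Finset.sum_const, Nat.card_Icc]
  simp only [add_tsub_cancel_right, nsmul_eq_mul]
  field_simp
  ring
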